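/- arXiv:1209.0516 — 2 statements merged into one kernel-verified Lean document; each statement's English description precedes it below -/
import Mathlib

section
/- Let δ(x,y) = ∃z₀…∃zₙ (x=z₀<⋯<zₙ=y) ∧ ⋀{φᵢ(zᵢ) : 0<i<n} ∧ ⋀{∀u ((z_{i−1}<u<z_i) → ψᵢ(u)) : 0<i≤n}, where φᵢ, ψᵢ are unary predicates, and for 1 ≤ j ≤ 2n−1 let δⱼ(x,y) = ∃z₀…∃z_k (x=z₀<⋯<z_k=y) ∧ ⋀{φᵢ(zᵢ) : 0<i≤⌊j/2⌋} ∧ ⋀{∀u ((z_{i−1}<u<z_i) → ψᵢ(u)) : 0<i≤k} where k = ⌈j/2⌉. Then for every interpretation of the predicates φᵢ, ψᵢ over ℝ and every x ∈ ℝ, δ(x, x+1) holds if and only if δ′(x) holds, where δ′(x) = (∀u ∈ (x, x+1). ⋁_{i=1}^{2n−1} δᵢ(x,u)) ∧ ∃y (y = x+1 ∧ ∃u ∈ (y−1, y). δ(u,y)). -/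
namespace MTLPaper

variable {K : AddSubgroup ℝ} {P : Type}

/-- `K ⊆ ℝ` is dense: between any two elements of `K` there is another element of `K`. -/
def DenseK (K : AddSubgroup ℝ) : Prop :=
  ∀ a ∈ K, ∀ b ∈ K, a < b → ∃ c ∈ K, a < c ∧ c < b

/-- A term of `FO_K`: a variable index together with a constant shift from `K`
(`(x, c)` denotes the term `x + c`; iterated shifts collapse since `K` is a group). -/
abbrev Term (K : AddSubgroup ℝ) : Type := ℕ × K

/-- Value of a term under a valuation of the variables. -/
def Term.val (v : ℕ → ℝ) (t : Term K) : ℝ := v t.1 + (t.2 : ℝ)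

/-- Formulas of the monadic logic of order and metric `FO_K`, over monadic predicates `P`. -/
inductive FO (K : AddSubgroup ℝ) (P : Type) : Type
  | tt : FO K P
  | atom : P → Term K → FO K P
  | lt : Term K → Term K → FO K P
  | conj : FO K P → FO K P → FO K P
  | neg : FO K P → FO K P
  | ex : ℕ → FO K P → FO K P

namespace FO

/-- Satisfaction of an `FO_K` formula over a signal `f` and a valuation `v`. -/
def sat (f : ℝ → Set P) : FO K P → (ℕ → ℝ) → Prop
  | tt, _ => True
  | atom p t, v => p ∈ f (Term.val v t)
  | lt s t, v => Term.val v s < Term.val v t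
  | conj φ ψ, v => sat f φ v ∧ sat f ψ v
  | neg φ, v => ¬ sat f φ v
  | ex x φ, v => ∃ r : ℝ, sat f φ (Function.update v x r)

/-- Free variables of an `FO_K` formula. -/
def free : FO K P → Set ℕ
  | tt => ∅
  | atom _ t => {t.1}
  | lt s t => {s.1, t.1}
  | conj φ ψ => free φ ∪ free ψ
  | neg φ => free φ
  | ex x φ => free φ \ {x}

/-- Quantifier depth. -/
def qdepth : FO K P → ℕ
  | tt => 0
  | atom _ _ => 0
  | lt _ _ => 0
  | conj φ ψ => max (qdepth φ) (qdepth ψ)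
  | neg φ => qdepth φ
  | ex _ φ => qdepth φ + 1

/-- Quantifier-free formulas. -/
def QFree : FO K P → Prop
  | tt => True
  | atom _ _ => True
  | lt _ _ => True
  | conj φ ψ => QFree φ ∧ QFree ψ
  | neg φ => QFree φ
  | ex _ _ => False

/-- `<`-free formulas. -/
def LtFree : FO K P → Prop
  | tt => True
  | atom _ _ => True
  | lt _ _ => False
  | conj φ ψ => LtFree φ ∧ LtFree ψ
  | neg φ => LtFree φ
  | ex _ φ => LtFree φ

/-- Membership in `Bet_K(t₁,t₂)`: every quantified subformula `∃z ψ` has the form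
`∃z ((t₁ < z < t₂) ∧ χ)`, and every monadic atom `P(t)` has `t` a bound occurrence of a
variable (no shift).  `B` records the set of variables bound so far. -/
def Bet (t₁ t₂ : Term K) : FO K P → Set ℕ → Prop
  | tt, _ => True
  | atom _ t, B => t.2 = (0 : K) ∧ t.1 ∈ B
  | lt _ _, _ => True
  | conj φ ψ, B => Bet t₁ t₂ φ B ∧ Bet t₁ t₂ ψ B
  | neg φ, B => Bet t₁ t₂ φ B
  | ex z (conj (conj (lt s u) (lt u' t)) χ), B =>
      s = t₁ ∧ t = t₂ ∧ u = (z, (0 : K)) ∧ u' = (z, (0 : K)) ∧ Bet t₁ t₂ χ (insert z B)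
  | ex _ _, _ => False

/-- `φ(x)` is `N`-bounded: it belongs to `Bet_K(x - N, x + N)`. -/
def NBounded (x : ℕ) (N : K) (φ : FO K P) : Prop :=
  Bet (x, -N) (x, N) φ (∅ : Set ℕ)

/-- The relativized quantifier `∃ y ∈ (s, t). φ`. -/
def guard (s t : Term K) (y : ℕ) (φ : FO K P) : FO K P :=
  ex y (conj (conj (lt s (y, (0 : K))) (lt (y, (0 : K)) t)) φ)

/-- The guard interval of the body of a quantifier on `z`, if it has guarded shape. -/
def guardOf (z : ℕ) : FO K P → Set (Term K × Term K)
  | conj (conj (lt s u) (lt u' t)) _ =>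
      {p | u = (z, (0 : K)) ∧ u' = (z, (0 : K)) ∧ p = (s, t)}
  | _ => ∅

/-- The guard intervals occurring in a formula. -/
def intervals : FO K P → Set (Term K × Term K)
  | tt => ∅
  | atom _ _ => ∅
  | lt _ _ => ∅
  | conj φ ψ => intervals φ ∪ intervals ψ
  | neg φ => intervals φ
  | ex z φ => guardOf z φ ∪ intervals φ

/-- Hierarchical Interval Formulas (HIFs).  Every `<`-free quantifier-free formula is a HIF;
HIFs are closed under negation and disjunction (`φ ∨ ψ := ¬(¬φ ∧ ¬ψ)`); and if `φ(x̄, y)` is a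
HIF such that the only guard intervals in `φ` involving `y` and a variable free in `φ` are of
the form `(x_l + c_l + c, y + c)` or `(y + c, x_r + c_r + c)` for some `c ∈ K`, then
`∃ y ∈ (x_l + c_l, x_r + c_r). φ` is a HIF. -/
inductive IsHIF : FO K P → Prop
  | base {φ : FO K P} : QFree φ → LtFree φ → IsHIF φ
  | negI {φ : FO K P} : IsHIF φ → IsHIF (neg φ)
  | disjI {φ ψ : FO K P} : IsHIF φ → IsHIF ψ → IsHIF (neg (conj (neg φ) (neg ψ)))
  | exI {φ : FO K P} {y xl xr : ℕ} {cl cr : K} :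
      IsHIF φ → xl ≠ y → xr ≠ y →
      (∀ s t : Term K, (s, t) ∈ intervals φ →
        (s.1 = y → t.1 ≠ y → t.1 ∈ free φ → ∃ c : K, s = (y, c) ∧ t = (xr, cr + c)) ∧
        (t.1 = y → s.1 ≠ y → s.1 ∈ free φ → ∃ c : K, t = (y, c) ∧ s = (xl, cl + c))) →
      IsHIF (guard (xl, cl) (xr, cr) y φ)

/-- A conjunction of constraints of the form `x_j + c < x_k + c'`. -/
def IsConstraintConj : FO K P → Prop
  | tt => True
  | atom _ _ => False
  | lt _ _ => True
  | conj φ ψ => IsConstraintConj φ ∧ IsConstraintConj ψ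
  | neg _ => False
  | ex _ _ => False

/-- The term `t` applies no nonzero shift unless its variable is `x`. -/
def TermOnly (x : ℕ) (t : Term K) : Prop := t.2 = (0 : K) ∨ t.1 = x

/-- The unary functions `+c` are applied only to the variable `x`. -/
def FnOnly (x : ℕ) : FO K P → Prop
  | tt => True
  | atom _ t => TermOnly x t
  | lt s t => TermOnly x s ∧ TermOnly x t
  | conj φ ψ => FnOnly x φ ∧ FnOnly x ψ
  | neg φ => FnOnly x φ
  | ex _ φ => FnOnly x φ

end FO

/-- Equivalence of two `FO_K` formulas: same truth value for every signal and valuation. -/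
def EquivFO (φ ψ : FO K P) : Prop :=
  ∀ (f : ℝ → Set P) (v : ℕ → ℝ), φ.sat f v ↔ ψ.sat f v

/-- An interval `I ⊆ (0,∞)` with endpoints in `K_{≥0} ∪ {∞}` (`hi = none` means `∞`). -/
structure MTLI (K : AddSubgroup ℝ) where
  lo : ℝ
  lo_mem : lo ∈ K
  lo_nonneg : 0 ≤ lo
  loClosed : Bool
  hi : Option ℝ
  hi_mem : ∀ h : ℝ, hi = some h → h ∈ K ∧ 0 ≤ h
  hiClosed : Bool
  pos : lo = 0 → loClosed = false

namespace MTLI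

/-- Membership in the interval. -/
def mem (I : MTLI K) (t : ℝ) : Prop :=
  (if I.loClosed then I.lo ≤ t else I.lo < t) ∧
  ∀ h : ℝ, I.hi = some h → (if I.hiClosed then t ≤ h else t < h)

/-- The interval is bounded. -/
def Bounded (I : MTLI K) : Prop := I.hi ≠ none

/-- The supremum of the interval, in `ℝ ∪ {∞}`. -/
def supW (I : MTLI K) : WithTop ℝ :=
  match I.hi with
  | none => ⊤
  | some h => (h : WithTop ℝ)

/-- The singleton (punctual) interval `{N}`, for `N ∈ K`, `N > 0`. -/
def single (N : ℝ) (hm : N ∈ K) (h0 : 0 < N) : MTLI K where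
  lo := N
  lo_mem := hm
  lo_nonneg := h0.le
  loClosed := true
  hi := some N
  hi_mem := fun h hh => by
    obtain rfl := (Option.some.inj hh).symm
    exact ⟨hm, h0.le⟩
  hiClosed := true
  pos := fun h => absurd h h0.ne'

/-- The unconstrained interval `(0, ∞)`. -/
def full : MTLI K where
  lo := 0
  lo_mem := zero_mem K
  lo_nonneg := le_refl 0
  loClosed := false
  hi := none
  hi_mem := fun _ hh => nomatch hh
  hiClosed := false
  pos := fun _ => rfl

end MTLI

/-- Formulas of `MTL_K` over atomic propositions `P`. -/
inductive MTL (K : AddSubgroup ℝ) (P : Type) : Type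
  | tt : MTL K P
  | atom : P → MTL K P
  | conj : MTL K P → MTL K P → MTL K P
  | neg : MTL K P → MTL K P
  | untl : MTL K P → MTL K P → MTLI K → MTL K P
  | sinc : MTL K P → MTL K P → MTLI K → MTL K P

namespace MTL

/-- Satisfaction of an `MTL_K` formula over a signal, at a point.
`untl φ ψ I` is `φ U_I ψ` and `sinc φ ψ I` is `φ S_I ψ`. -/
def sat (f : ℝ → Set P) : MTL K P → ℝ → Prop
  | tt, _ => True
  | atom p, r => p ∈ f r
  | conj φ ψ, r => sat f φ r ∧ sat f ψ r
  | neg φ, r => ¬ sat f φ r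
  | untl φ ψ I, r =>
      ∃ t : ℝ, r < t ∧ I.mem (t - r) ∧ sat f ψ t ∧ ∀ u, r < u → u < t → sat f φ u
  | sinc φ ψ I, r =>
      ∃ t : ℝ, t < r ∧ I.mem (r - t) ∧ sat f ψ t ∧ ∀ u, t < u → u < r → sat f φ u

/-- All intervals occurring in the temporal operators are bounded. -/
def AllBounded : MTL K P → Prop
  | tt => True
  | atom _ => True
  | conj φ ψ => AllBounded φ ∧ AllBounded ψ
  | neg φ => AllBounded φ
  | untl φ ψ I => I.Bounded ∧ AllBounded φ ∧ AllBounded ψ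
  | sinc φ ψ I => I.Bounded ∧ AllBounded φ ∧ AllBounded ψ

/-- LTL formulas: MTL formulas using only the interval `(0, ∞)`. -/
def IsLTL : MTL K P → Prop
  | tt => True
  | atom _ => True
  | conj φ ψ => IsLTL φ ∧ IsLTL ψ
  | neg φ => IsLTL φ
  | untl φ ψ I => I = MTLI.full ∧ IsLTL φ ∧ IsLTL ψ
  | sinc φ ψ I => I = MTLI.full ∧ IsLTL φ ∧ IsLTL ψ

/-- Future reach. -/
noncomputable def fr : MTL K P → WithTop ℝ
  | tt => 0
  | atom _ => 0
  | conj φ ψ => max (fr φ) (fr ψ)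
  | neg φ => fr φ
  | untl φ ψ I => I.supW + max (fr φ) (fr ψ)
  | sinc φ ψ I => max (fr φ) (WithTop.map (fun x => x - I.lo) (fr ψ))

/-- Past reach. -/
noncomputable def pr : MTL K P → WithTop ℝ
  | tt => 0
  | atom _ => 0
  | conj φ ψ => max (pr φ) (pr ψ)
  | neg φ => pr φ
  | untl φ ψ I => max (pr φ) (WithTop.map (fun x => x - I.lo) (pr ψ))
  | sinc φ ψ I => I.supW + max (pr φ) (pr ψ)

/-- Boolean combinations of formulas from a class `S`. -/
inductive BC (S : MTL K P → Prop) : MTL K P → Prop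
  | base {φ : MTL K P} : S φ → BC S φ
  | negB {φ : MTL K P} : BC S φ → BC S (neg φ)
  | conjB {φ ψ : MTL K P} : BC S φ → BC S ψ → BC S (conj φ ψ)

end MTL

/-- Equivalence of two `MTL_K` formulas. -/
def EquivMTL (φ ψ : MTL K P) : Prop :=
  ∀ (f : ℝ → Set P) (r : ℝ), φ.sat f r ↔ ψ.sat f r

/-- Equivalence of an `FO_K` formula with (at most) free variable `0` and an `MTL_K` formula. -/
def EquivFOMTL (φ : FO K P) (ψ : MTL K P) : Prop :=
  ∀ (f : ℝ → Set P) (r : ℝ), φ.sat f (fun _ => r) ↔ ψ.sat f r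

/-- `MTL_K` and `FO_K` have the same expressive power. -/
def SameExpressive (K : AddSubgroup ℝ) (P : Type) : Prop :=
  (∀ φ : FO K P, φ.free ⊆ {0} → ∃ ψ : MTL K P, EquivFOMTL φ ψ) ∧
  (∀ ψ : MTL K P, ∃ φ : FO K P, φ.free ⊆ {0} ∧ EquivFOMTL φ ψ)

/-- Formulas of `MTL_K` with counting modalities. -/
inductive MTLC (K : AddSubgroup ℝ) (P : Type) : Type
  | tt : MTLC K P
  | atom : P → MTLC K P
  | conj : MTLC K P → MTLC K P → MTLC K P
  | neg : MTLC K P → MTLC K P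
  | untl : MTLC K P → MTLC K P → MTLI K → MTLC K P
  | sinc : MTLC K P → MTLC K P → MTLI K → MTLC K P
  | fcount : ℕ → MTLC K P → MTLC K P
  | pcount : ℕ → MTLC K P → MTLC K P

namespace MTLC

/-- Satisfaction of an `MTL_K+C` formula. -/
def sat (f : ℝ → Set P) : MTLC K P → ℝ → Prop
  | tt, _ => True
  | atom p, r => p ∈ f r
  | conj φ ψ, r => sat f φ r ∧ sat f ψ r
  | neg φ, r => ¬ sat f φ r
  | untl φ ψ I, r =>
      ∃ t : ℝ, r < t ∧ I.mem (t - r) ∧ sat f ψ t ∧ ∀ u, r < u → u < t → sat f φ u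
  | sinc φ ψ I, r =>
      ∃ t : ℝ, t < r ∧ I.mem (r - t) ∧ sat f ψ t ∧ ∀ u, t < u → u < r → sat f φ u
  | fcount n φ, r =>
      ∃ s : Fin n → ℝ, StrictMono s ∧ ∀ i, s i ∈ Set.Ioo r (r + 1) ∧ sat f φ (s i)
  | pcount n φ, r =>
      ∃ s : Fin n → ℝ, StrictMono s ∧ ∀ i, s i ∈ Set.Ioo (r - 1) r ∧ sat f φ (s i)

end MTLC

/-- The integers, as an additive subgroup of `ℝ`. -/
def intZ : AddSubgroup ℝ := AddSubgroup.zmultiples (1 : ℝ)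

/-- Equivalence of an `FO_K` formula with free variable `0` and an `MTL_K+C` formula. -/
def EquivFOMTLC (φ : FO K P) (ψ : MTLC K P) : Prop :=
  ∀ (f : ℝ → Set P) (r : ℝ), φ.sat f (fun _ => r) ↔ ψ.sat f r

/-- Formulas of PQ2MLO: Q2MLO with punctuality. -/
inductive PQ (P : Type) : Type
  | tt : PQ P
  | atom : P → ℕ → PQ P
  | lt : ℕ → ℕ → PQ P
  | conj : PQ P → PQ P → PQ P
  | neg : PQ P → PQ P
  | ex : ℕ → PQ P → PQ P
  | exFutI : ℕ → ℕ → PQ P → PQ P  -- ∃ y ∈ (x, x+1). ψ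
  | exPastI : ℕ → ℕ → PQ P → PQ P -- ∃ y ∈ (x-1, x). ψ
  | exFutP : ℕ → ℕ → PQ P → PQ P  -- ∃ y (y = x+1 ∧ χ)
  | exPastP : ℕ → ℕ → PQ P → PQ P -- ∃ y (y = x-1 ∧ χ)

namespace PQ

/-- Satisfaction of a PQ2MLO formula. -/
def sat (f : ℝ → Set P) : PQ P → (ℕ → ℝ) → Prop
  | tt, _ => True
  | atom p x, v => p ∈ f (v x)
  | lt x y, v => v x < v y
  | conj φ ψ, v => sat f φ v ∧ sat f ψ v
  | neg φ, v => ¬ sat f φ v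
  | ex x φ, v => ∃ r : ℝ, sat f φ (Function.update v x r)
  | exFutI x y ψ, v => ∃ r : ℝ, v x < r ∧ r < v x + 1 ∧ sat f ψ (Function.update v y r)
  | exPastI x y ψ, v => ∃ r : ℝ, v x - 1 < r ∧ r < v x ∧ sat f ψ (Function.update v y r)
  | exFutP x y χ, v => ∃ r : ℝ, r = v x + 1 ∧ sat f χ (Function.update v y r)
  | exPastP x y χ, v => ∃ r : ℝ, r = v x - 1 ∧ sat f χ (Function.update v y r)

/-- Free variables of a PQ2MLO formula. -/
def free : PQ P → Set ℕ
  | tt => ∅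
  | atom _ x => {x}
  | lt x y => {x, y}
  | conj φ ψ => free φ ∪ free ψ
  | neg φ => free φ
  | ex x φ => free φ \ {x}
  | exFutI x y ψ => insert x (free ψ \ {y})
  | exPastI x y ψ => insert x (free ψ \ {y})
  | exFutP x y χ => insert x (free χ \ {y})
  | exPastP x y χ => insert x (free χ \ {y})

/-- Well-formedness: in `∃y∈(x,x+1) ψ` and `∃y∈(x-1,x) ψ` the formula `ψ` has exactly the
free variables `x` and `y`; in `∃y (y = x±1 ∧ χ)` the formula `χ` has exactly the free
variable `y`. -/
def WF : PQ P → Prop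
  | tt => True
  | atom _ _ => True
  | lt _ _ => True
  | conj φ ψ => WF φ ∧ WF ψ
  | neg φ => WF φ
  | ex _ φ => WF φ
  | exFutI x y ψ => x ≠ y ∧ free ψ = {x, y} ∧ WF ψ
  | exPastI x y ψ => x ≠ y ∧ free ψ = {x, y} ∧ WF ψ
  | exFutP x y χ => x ≠ y ∧ free χ = {y} ∧ WF χ
  | exPastP x y χ => x ≠ y ∧ free χ = {y} ∧ WF χ

end PQ

/-- Equivalence of an `FO_ℤ` formula with free variable `0` and a PQ2MLO formula
with free variable `0`. -/
def EquivFOPQ (φ : FO intZ P) (π : PQ P) : Prop :=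
  ∀ (f : ℝ → Set P) (r : ℝ), φ.sat f (fun _ => r) ↔ π.sat f (fun _ => r)

/-- Equivalence of a PQ2MLO formula with free variable `0` and an `MTL_ℤ+C` formula. -/
def EquivPQMTLC (π : PQ P) (ψ : MTLC intZ P) : Prop :=
  ∀ (f : ℝ → Set P) (r : ℝ), π.sat f (fun _ => r) ↔ ψ.sat f r

/-- The singleton interval `{1}` over the integer constants. -/
def oneI : MTLI intZ := MTLI.single 1 (AddSubgroup.mem_zmultiples (1 : ℝ)) one_pos

/-- The interpretation of the enlarged set of monadic predicates: the predicate `(p, c)`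
(i.e. `P^c`) holds at `r` iff `p` holds at `r + c`. -/
def liftSig (K : AddSubgroup ℝ) (f : ℝ → Set P) : ℝ → Set (P × K) :=
  fun r => {pc : P × K | pc.1 ∈ f (r + (pc.2 : ℝ))}

/-- Semantics of a decomposition formula `δ(x,y)`:
`x < y ∧ ∃ z₀ … zₙ (x = z₀ < ⋯ < zₙ = y) ∧ ⋀ φᵢ(zᵢ) ∧ ⋀ ∀u (z_{i-1} < u < z_i → ψᵢ(u))`,
where the `φᵢ`, `ψᵢ` are MTL formulas regarded as unary predicates. -/
def DecompSat (f : ℝ → Set P) (n : ℕ) (φ ψ : ℕ → MTL K P) (x y : ℝ) : Prop :=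
  x < y ∧ ∃ z : ℕ → ℝ, z 0 = x ∧ z n = y ∧ (∀ i < n, z i < z (i + 1)) ∧
    (∀ i, 0 < i → i < n → (φ i).sat f (z i)) ∧
    (∀ i, 0 < i → i ≤ n → ∀ u, z (i - 1) < u → u < z i → (ψ i).sat f u)

/-- Semantics of `δ(x,y)` for abstract unary predicates (no `x < y` conjunct). -/
def Delta (φ ψ : ℕ → ℝ → Prop) (n : ℕ) (x y : ℝ) : Prop :=
  ∃ z : ℕ → ℝ, z 0 = x ∧ z n = y ∧ (∀ i < n, z i < z (i + 1)) ∧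
    (∀ i, 0 < i → i < n → φ i (z i)) ∧
    (∀ i, 0 < i → i ≤ n → ∀ u, z (i - 1) < u → u < z i → ψ i u)

/-- Semantics of `δⱼ(x,y)`: the restriction of `δ` to the first `j` formulas of
`ψ₁, φ₁, ψ₂, φ₂, …, ψₙ`, with `k = ⌈j/2⌉` existential quantifiers after `z₀`. -/
def DeltaJ (φ ψ : ℕ → ℝ → Prop) (j : ℕ) (x y : ℝ) : Prop :=
  ∃ z : ℕ → ℝ, z 0 = x ∧ z ((j + 1) / 2) = y ∧ (∀ i < (j + 1) / 2, z i < z (i + 1)) ∧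
    (∀ i, 0 < i → i ≤ j / 2 → φ i (z i)) ∧
    (∀ i, 0 < i → i ≤ (j + 1) / 2 → ∀ u, z (i - 1) < u → u < z i → ψ i u)

/-- The three kinds of formulas in the separation lemma, for the constant `c`:
`◇_{{N}} θ` with `pr θ < N - c`; `◇⁻_{{N}} θ` with `fr θ < N - c`; and formulas in which
all intervals of temporal operators are bounded. -/
def SepKind (c : ℝ) (χ : MTL K P) : Prop :=
  (∃ (N : ℝ) (hm : N ∈ K) (h0 : 0 < N) (θ : MTL K P),
      χ = MTL.untl MTL.tt θ (MTLI.single N hm h0) ∧ θ.pr < ((N - c : ℝ) : WithTop ℝ)) ∨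
  (∃ (N : ℝ) (hm : N ∈ K) (h0 : 0 < N) (θ : MTL K P),
      χ = MTL.sinc MTL.tt θ (MTLI.single N hm h0) ∧ θ.fr < ((N - c : ℝ) : WithTop ℝ)) ∨
  χ.AllBounded


theorem le_of_chain_lt {z : ℕ → ℝ} {n : ℕ} (hz : ∀ i < n, z i < z (i + 1)) {a b : ℕ}
    (hab : a ≤ b) (hb : b ≤ n) : z a ≤ z b := by
  induction b, hab using Nat.le_induction with
  | base => exact le_rfl
  | succ m _ ih => exact (ih (by omega)).trans (hz m (by omega)).le

theorem Delta.pos {φ ψ : ℕ → ℝ → Prop} {n : ℕ} {x y : ℝ} (h : Delta φ ψ n x y) (hxy : x ≠ y) :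
    0 < n := by
  obtain ⟨z, h0, hn, -⟩ := h
  rcases Nat.eq_zero_or_pos n with rfl | h
  · exact absurd (h0.symm.trans hn) hxy
  · exact h

/-- Every point strictly between the endpoints of `δ` satisfies one of its initial segments. -/
theorem Delta.exists_deltaJ {φ ψ : ℕ → ℝ → Prop} {n : ℕ} {x y u : ℝ} (h : Delta φ ψ n x y)
    (hxu : x < u) (huy : u < y) : ∃ j, 1 ≤ j ∧ j ≤ 2 * n - 1 ∧ DeltaJ φ ψ j x u := by
  classical
  obtain ⟨z, h0, hn, hz, hφ, hψ⟩ := h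
  have hex : ∃ i, u ≤ z i := ⟨n, by rw [hn]; exact huy.le⟩
  obtain ⟨i, hi, hmin⟩ : ∃ i, u ≤ z i ∧ ∀ m < i, z m < u :=
    ⟨Nat.find hex, Nat.find_spec hex, fun m hm => not_le.1 (Nat.find_min hex hm)⟩
  have hipos : 0 < i := by
    rcases Nat.eq_zero_or_pos i with rfl | h
    · linarith
    · exact h
  have hin : i ≤ n := by
    by_contra! hlt
    linarith [hmin n hlt]
  rcases hi.lt_or_eq with hlt | heq
  · have hk : (2 * i - 1 + 1) / 2 = i := by omega
    have hk' : (2 * i - 1) / 2 = i - 1 := by omega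
    refine ⟨2 * i - 1, by omega, by omega, Function.update z i u, ?_⟩
    have hup (m : ℕ) (hm : m < i) : Function.update z i u m = z m :=
      Function.update_of_ne hm.ne _ _
    rw [hk, hk']
    refine ⟨by rw [hup 0 hipos, h0], by simp, fun m hm => ?_, fun m hm hmi => ?_,
      fun m hm hmi v hv hv' => ?_⟩
    · rw [hup m hm]
      rcases (Nat.succ_le_of_lt hm).lt_or_eq with hm' | hm'
      · rw [hup _ hm']
        exact hz m (by omega)
      · rw [show m + 1 = i from hm', Function.update_self]
        exact hmin m hm
    · rw [hup m (by omega)]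
      exact hφ m hm (by omega)
    · rw [hup _ (by omega)] at hv
      refine hψ m hm (by omega) v hv ?_
      rcases hmi.lt_or_eq with hm' | rfl
      · rwa [hup _ hm'] at hv'
      · rw [Function.update_self] at hv'
        exact hv'.trans hlt
  · have hne : i ≠ n := by
      rintro rfl
      linarith
    have hk : (2 * i + 1) / 2 = i := by omega
    have hk' : 2 * i / 2 = i := by omega
    refine ⟨2 * i, by omega, by omega, z, ?_⟩
    rw [hk, hk']
    exact ⟨h0, heq.symm, fun m hm => hz m (by omega), fun m hm hmi => hφ m hm (by omega),
      fun m hm hmi => hψ m hm (by omega)⟩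

/-- The left endpoint of `δ` can be moved slightly to the right. -/
theorem Delta.exists_shrink_left {φ ψ : ℕ → ℝ → Prop} {n : ℕ} {x y : ℝ} (h : Delta φ ψ n x y)
    (hxy : x < y) : ∃ u, x < u ∧ u < y ∧ Delta φ ψ n u y := by
  have hpos := h.pos hxy.ne
  obtain ⟨z, h0, hn, hz, hφ, hψ⟩ := h
  obtain ⟨u, hu, hu'⟩ := exists_between (hz 0 hpos)
  rw [h0] at hu
  have hup (m : ℕ) (hm : 0 < m) : Function.update z 0 u m = z m :=
    Function.update_of_ne hm.ne' _ _
  refine ⟨u, hu, hu'.trans_le (hn ▸ le_of_chain_lt hz hpos le_rfl),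
    Function.update z 0 u, by simp, by rw [hup n hpos, hn], fun m hm => ?_, fun m hm hmn => ?_,
    fun m hm hmn v hv hv' => ?_⟩
  · rcases Nat.eq_zero_or_pos m with rfl | hm'
    · rwa [Function.update_self, hup _ (by omega)]
    · rw [hup m hm', hup _ (by omega)]
      exact hz m hm
  · rw [hup m hm]
    exact hφ m hm hmn
  · rw [hup m hm] at hv'
    refine hψ m hm hmn v ?_ hv'
    rcases Nat.eq_zero_or_pos (m - 1) with h | h
    · rw [h, Function.update_self] at hv
      rw [h, h0]
      exact hu.trans hv
    · rwa [hup _ h] at hv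

/-- If `δ(u, y)` holds and every point of `(x, y)` satisfies an initial segment of `δ` started
at `x < u`, then `δ(x, y)` holds: the two witnessing sequences can be spliced. -/
theorem Delta.extend_left {φ ψ : ℕ → ℝ → Prop} {n : ℕ} {x y u : ℝ} (h : Delta φ ψ n u y)
    (hxu : x < u) (huy : u < y)
    (hJ : ∀ v, x < v → v < y → ∃ j, 1 ≤ j ∧ j ≤ 2 * n - 1 ∧ DeltaJ φ ψ j x v) :
    Delta φ ψ n x y := by
  classical
  have hpos := h.pos huy.ne
  obtain ⟨w, hw0, hwn, hw, hwφ, hwψ⟩ := h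
  have hlast : w (n - 1) < y := by
    have := hw (n - 1) (by omega)
    rwa [Nat.sub_add_cancel hpos, hwn] at this
  obtain ⟨v, hv, hvy⟩ := exists_between hlast
  have huw : u ≤ w (n - 1) := hw0 ▸ le_of_chain_lt hw (Nat.zero_le _) (Nat.sub_le _ _)
  obtain ⟨j, hj1, hjn, z, hz0, hzk, hz, hzφ, hzψ⟩ := hJ v (by linarith) hvy
  obtain ⟨k, hk⟩ : ∃ k, k + 1 = (j + 1) / 2 := ⟨(j + 1) / 2 - 1, by omega⟩
  rw [← hk] at hzk hz hzψ
  have hex : ∃ i, w i < z (i + 1) :=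
    ⟨k, by rw [hzk]; exact (le_of_chain_lt hw (by omega) (Nat.sub_le _ _)).trans_lt hv⟩
  obtain ⟨i, hi, hmin⟩ : ∃ i, w i < z (i + 1) ∧ ∀ m < i, z (m + 1) ≤ w m :=
    ⟨Nat.find hex, Nat.find_spec hex, fun m hm => not_lt.1 (Nat.find_min hex hm)⟩
  have hik : i ≤ k := by
    by_contra! hlt
    have := hmin k hlt
    rw [hzk] at this
    linarith [le_of_chain_lt hw (show k ≤ n - 1 by omega) (Nat.sub_le _ _)]
  have hzw : z i < w i := by
    rcases i with _ | m
    · rwa [hz0, hw0]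
    · exact (hmin m (by omega)).trans_lt (hw m (by omega))
  refine ⟨fun m => if m ≤ i then z m else w m, by simpa using hz0, ?_, fun m hm => ?_,
    fun m hm hmn => ?_, fun m hm hmn t ht ht' => ?_⟩
  · dsimp only
    rw [if_neg (by omega), hwn]
  · dsimp only
    rcases lt_trichotomy m i with h | rfl | h
    · rw [if_pos h.le, if_pos (by omega)]
      exact hz m (by omega)
    · rw [if_pos le_rfl, if_neg (by omega)]
      exact hzw.trans (hw m hm)
    · rw [if_neg (by omega), if_neg (by omega)]
      exact hw m hm
  · dsimp only
    split_ifs with h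
    · exact hzφ m hm (by omega)
    · exact hwφ m hm hmn
  · obtain ⟨m, rfl⟩ : ∃ l, m = l + 1 := ⟨m - 1, by omega⟩
    dsimp only at ht ht'
    rw [Nat.add_sub_cancel] at ht
    rcases lt_trichotomy m i with h | rfl | h
    · rw [if_pos h.le] at ht
      rw [if_pos (by omega)] at ht'
      exact hzψ (m + 1) hm (by omega) t ht ht'
    · rw [if_pos le_rfl] at ht
      rw [if_neg (by omega)] at ht'
      rcases lt_or_ge t (z (m + 1)) with h | h
      · exact hzψ (m + 1) hm (by omega) t ht h
      · exact hwψ (m + 1) hm hmn t (hi.trans_le h) ht'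
    · rw [if_neg (by omega)] at ht ht'
      exact hwψ (m + 1) hm hmn t ht ht'

/-- **Lemma (Section 4).** `δ(x, x+1)` holds iff `δ'(x)` holds, where
`δ'(x) = (∀ u ∈ (x, x+1). ⋁_{j=1}^{2n-1} δⱼ(x,u)) ∧ ∃ y (y = x+1 ∧ ∃ u ∈ (y-1, y). δ(u,y))`. -/
theorem delta_equiv_delta' (n : ℕ) (φ ψ : ℕ → ℝ → Prop) (x : ℝ) :
    Delta φ ψ n x (x + 1) ↔
      ((∀ u : ℝ, x < u → u < x + 1 → ∃ j, 1 ≤ j ∧ j ≤ 2 * n - 1 ∧ DeltaJ φ ψ j x u) ∧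
       (∃ y : ℝ, y = x + 1 ∧ ∃ u : ℝ, y - 1 < u ∧ u < y ∧ Delta φ ψ n u y)) := by
  constructor
  · intro h
    refine ⟨fun u hu hu' => h.exists_deltaJ hu hu', x + 1, rfl, ?_⟩
    obtain ⟨u, hu, hu', hd⟩ := h.exists_shrink_left (lt_add_one x)
    exact ⟨u, by linarith, hu', hd⟩
  · rintro ⟨hJ, y, rfl, u, hu, hu', hd⟩
    exact hd.extend_left (by linarith) hu' hJ

end MTLPaper
end

section
/- Let K be an additive subgroup of ℝ and let φ(x̄) = ∃y ∈ (s,t). ψ(x̄,y) be a HIF, and let u be a term over the variables x̄. Then there exist HIFs θ^<(x̄) of the form ∃y ∈ (s,u). ψ^<(x̄,y) and θ^>(x̄) of the form ∃y ∈ (u,t). ψ^>(x̄,y), and a HIF θ^=(x̄) of strictly smaller quantifier depth than φ, such that under every signal and every assignment of x̄ satisfying s < u < t, φ(x̄) holds if and only if θ^<(x̄) ∨ θ^=(x̄) ∨ θ^>(x̄) holds. -/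
namespace MTLPaper

variable {K : AddSubgroup ℝ} {P : Type}

namespace Term

/-- The term `t + d`. -/
def shift (t : Term K) (d : K) : Term K := (t.1, t.2 + d)

/-- Substitution of terms for variables in a term. -/
def subst (σ : ℕ → Term K) (t : Term K) : Term K := (σ t.1).shift t.2

theorem val_shift (v : ℕ → ℝ) (t : Term K) (d : K) : (t.shift d).val v = t.val v + d := by
  simp [val, shift, add_assoc]

theorem shift_injective (d : K) : Function.Injective fun t : Term K => t.shift d := by
  intro s t h
  obtain ⟨h1, h2⟩ := Prod.mk.inj h
  exact Prod.ext h1 (add_right_cancel h2)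

theorem subst_mk_add (σ : ℕ → Term K) (t : Term K) (d : K) :
    subst σ (t.1, t.2 + d) = (subst σ t).shift d := by
  simp [subst, shift, add_assoc]

theorem val_subst {σ : ℕ → Term K} {v w : ℕ → ℝ} {t : Term K} (h : w t.1 = (σ t.1).val v) :
    (subst σ t).val v = t.val w := by
  rw [subst, val_shift, ← h]; rfl

theorem val_update {t : Term K} {k : ℕ} (h : t.1 ≠ k) (v : ℕ → ℝ) (r : ℝ) :
    t.val (Function.update v k r) = t.val v := by
  simp [val, h]

end Term

namespace FO

theorem exists_free_lt (φ : FO K P) : ∃ N : ℕ, ∀ x ∈ φ.free, x < N := by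
  induction φ with
  | tt => exact ⟨0, by simp [free]⟩
  | atom p t => exact ⟨t.1 + 1, by simp [free]⟩
  | lt s t =>
    refine ⟨max s.1 t.1 + 1, ?_⟩
    rintro x (rfl | rfl)
    · omega
    · omega
  | conj φ ψ hφ hψ =>
    obtain ⟨M, hM⟩ := hφ
    obtain ⟨N, hN⟩ := hψ
    refine ⟨max M N, ?_⟩
    rintro x (hx | hx)
    · exact lt_max_of_lt_left (hM x hx)
    · exact lt_max_of_lt_right (hN x hx)
  | neg φ hφ => exact hφ
  | ex x φ hφ =>
    obtain ⟨N, hN⟩ := hφ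
    exact ⟨N, fun z hz => hN z hz.1⟩

theorem QFree.intervals_eq {φ : FO K P} (h : φ.QFree) : φ.intervals = ∅ := by
  induction φ with
  | conj φ ψ hφ hψ => simp [intervals, hφ h.1, hψ h.2]
  | neg φ hφ => exact hφ h
  | ex => exact h.elim
  | _ => rfl

theorem QFree.qdepth_eq {φ : FO K P} (h : φ.QFree) : φ.qdepth = 0 := by
  induction φ with
  | conj φ ψ hφ hψ => simp [qdepth, hφ h.1, hψ h.2]
  | neg φ hφ => exact hφ h
  | ex => exact h.elim
  | _ => rfl

theorem QFree.exists_subst {φ : FO K P} (h : φ.QFree) (h' : φ.LtFree) (σ : ℕ → Term K) (n : ℕ)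
    (hσ : ∀ x ∈ φ.free, (σ x).1 < n) :
    ∃ T : FO K P, T.QFree ∧ T.LtFree ∧ (∀ x ∈ T.free, x < n) ∧
      ∀ (f : ℝ → Set P) (v w : ℕ → ℝ), (∀ x ∈ φ.free, w x = (σ x).val v) →
        (T.sat f v ↔ φ.sat f w) := by
  induction φ with
  | tt => exact ⟨tt, trivial, trivial, by simp [free], fun _ _ _ _ => Iff.rfl⟩
  | atom p t =>
    refine ⟨atom p (Term.subst σ t), trivial, trivial, ?_, ?_⟩
    · rintro x rfl
      exact hσ t.1 rfl
    · intro f v w hw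
      simp only [sat]
      rw [Term.val_subst (hw t.1 rfl)]
  | lt => exact h'.elim
  | conj φ ψ hφ hψ =>
    obtain ⟨S, S1, S2, S3, S4⟩ := hφ h.1 h'.1 fun x hx => hσ x (Or.inl hx)
    obtain ⟨T, T1, T2, T3, T4⟩ := hψ h.2 h'.2 fun x hx => hσ x (Or.inr hx)
    refine ⟨conj S T, ⟨S1, T1⟩, ⟨S2, T2⟩, ?_, ?_⟩
    · rintro x (hx | hx)
      exacts [S3 x hx, T3 x hx]
    · intro f v w hw
      exact and_congr (S4 f v w fun x hx => hw x (Or.inl hx))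
        (T4 f v w fun x hx => hw x (Or.inr hx))
  | neg φ hφ =>
    obtain ⟨T, T1, T2, T3, T4⟩ := hφ h h' hσ
    exact ⟨neg T, T1, T2, T3, fun f v w hw => not_congr (T4 f v w hw)⟩
  | ex => exact h.elim

theorem sat_guard {s t : Term K} {y : ℕ} (hs : s.1 ≠ y) (ht : t.1 ≠ y) (φ : FO K P)
    (f : ℝ → Set P) (v : ℕ → ℝ) :
    (guard s t y φ).sat f v ↔
      ∃ r, s.val v < r ∧ r < t.val v ∧ φ.sat f (Function.update v y r) := by
  have h (r : ℝ) : Term.val (Function.update v y r) ((y, 0) : Term K) = r := by simp [Term.val]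
  simp only [guard, sat, Term.val_update hs, Term.val_update ht, h, and_assoc]

theorem mem_free_guard {s t : Term K} {y : ℕ} (hs : s.1 ≠ y) (ht : t.1 ≠ y) {φ : FO K P} {x : ℕ} :
    x ∈ (guard s t y φ).free ↔ x = s.1 ∨ x = t.1 ∨ (x ∈ φ.free ∧ x ≠ y) := by
  simp only [guard, free, Set.mem_sdiff, Set.mem_union, Set.mem_insert_iff, Set.mem_singleton_iff]
  constructor
  · tauto
  · rintro (rfl | rfl | h)
    · tauto
    · tauto
    · tauto

theorem mem_intervals_guard {s t : Term K} {y : ℕ} {φ : FO K P} {I : Term K × Term K} :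
    I ∈ (guard s t y φ).intervals ↔ I = (s, t) ∨ I ∈ φ.intervals := by
  simp [guard, intervals, guardOf]

theorem qdepth_guard (s t : Term K) (y : ℕ) (φ : FO K P) :
    (guard s t y φ).qdepth = φ.qdepth + 1 := by
  simp [guard, qdepth]

/-- Disjunction. -/
def disj (φ ψ : FO K P) : FO K P := neg (conj (neg φ) (neg ψ))

theorem sat_disj (φ ψ : FO K P) (f : ℝ → Set P) (v : ℕ → ℝ) :
    (disj φ ψ).sat f v ↔ φ.sat f v ∨ ψ.sat f v := by
  simp only [disj, sat]; tauto

/-- `m` is the splitting point of the interval `(a, b)`: here `lo x = some e` records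
`x < w + e`, while `hi x = some e` records `w + e < x`. -/
structure Cross (w : ℕ) (lo hi : ℕ → Option K) (a b m : Term K) : Prop where
  base : m.1 = w
  left : lo a.1 = some (m.2 - a.2)
  right : hi b.1 = some (m.2 - b.2)
  ne_left : a ≠ m
  ne_right : b ≠ m

/-- The valuation `v` respects the bounds recorded by `lo` and `hi`. -/
def Sound (w : ℕ) (lo hi : ℕ → Option K) (v : ℕ → ℝ) : Prop :=
  (∀ x e, lo x = some e → v x < v w + e) ∧ ∀ x e, hi x = some e → v w + e < v x

/-- Splitting the interval `(a, b)`, if it has a splitting point, yields intervals in `G`. -/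
def Splits (w : ℕ) (lo hi : ℕ → Option K) (G : Term K → Term K → Prop) (a b : Term K) : Prop :=
  (∀ m, Cross w lo hi a b m → G a m ∧ G m b) ∧ ((∀ m, ¬ Cross w lo hi a b m) → G a b)

/-- The intervals of `φ` between free variables satisfy `R` after substitution by `σ`. -/
def IntervalsIn (σ : ℕ → Term K) (R : Term K → Term K → Prop) (φ : FO K P) : Prop :=
  ∀ p q, (p, q) ∈ φ.intervals → p.1 ∈ φ.free → q.1 ∈ φ.free → R (Term.subst σ p) (Term.subst σ q)

/-- A class of intervals that is closed under shifts and contains all intervals whose endpoints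
have the same variable. -/
structure Admissible (G : Term K → Term K → Prop) : Prop where
  same : ∀ a b : Term K, a.1 = b.1 → G a b
  shift : ∀ (a b : Term K) (d : K), G a b → G (a.shift d) (b.shift d)

/-- The intervals allowed in the body of `∃ k ∈ (a, b)`, if those not involving `k` are
restricted to `G`. -/
def Extend (G : Term K → Term K → Prop) (k : ℕ) (a b : Term K) (s t : Term K) : Prop :=
  (s.1 ≠ k → t.1 ≠ k → G s t) ∧
  (s.1 = k → t.1 ≠ k → ∃ c : K, s = (k, c) ∧ t = (b.1, b.2 + c)) ∧
  (t.1 = k → s.1 ≠ k → ∃ c : K, t = (k, c) ∧ s = (a.1, a.2 + c))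

/-- `T` is a HIF equivalent to `φ` under the substitution `σ`, for valuations respecting
`lo` and `hi`, whose free variables are below `n` and whose intervals between variables below `n`
belong to `G`. -/
structure IsTranslation (w : ℕ) (σ : ℕ → Term K) (lo hi : ℕ → Option K)
    (G : Term K → Term K → Prop) (n : ℕ) (φ T : FO K P) : Prop where
  isHIF : T.IsHIF
  qdepth_le : T.qdepth ≤ φ.qdepth
  free_lt : ∀ x ∈ T.free, x < n
  mem_intervals : ∀ a b, (a, b) ∈ T.intervals → a.1 < n → b.1 < n → G a b
  sat_iff : ∀ (f : ℝ → Set P) (v v' : ℕ → ℝ), Sound w lo hi v →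
    (∀ x ∈ φ.free, v' x = (σ x).val v) → (T.sat f v ↔ φ.sat f v')

/-- `φ` has a translation for all admissible data. -/
def Translatable (w : ℕ) (φ : FO K P) : Prop :=
  ∀ (σ : ℕ → Term K) (lo hi : ℕ → Option K) (G : Term K → Term K → Prop) (n : ℕ),
    w < n → (∀ x ∈ φ.free, (σ x).1 < n) → Admissible G →
    IntervalsIn σ (Splits w lo hi G) φ → ∃ T, IsTranslation w σ lo hi G n φ T

/-- The side condition on the intervals of the body of `∃ z ∈ (p, q)` in a HIF. -/
def BodyCond (z : ℕ) (p q : Term K) (φ : FO K P) : Prop :=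
  ∀ s t : Term K, (s, t) ∈ intervals φ →
    (s.1 = z → t.1 ≠ z → t.1 ∈ free φ → ∃ c : K, s = (z, c) ∧ t = (q.1, q.2 + c)) ∧
    (t.1 = z → s.1 ≠ z → s.1 ∈ free φ → ∃ c : K, t = (z, c) ∧ s = (p.1, p.2 + c))

theorem Cross.lt {w : ℕ} {lo hi : ℕ → Option K} {a b m : Term K} (h : Cross w lo hi a b m)
    {v : ℕ → ℝ} (hv : Sound w lo hi v) : a.val v < m.val v ∧ m.val v < b.val v := by
  have h1 := hv.1 _ _ h.left
  have h2 := hv.2 _ _ h.right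
  rw [← h.base] at h1 h2
  push_cast at h1 h2
  simp only [Term.val]
  constructor <;> linarith

theorem Admissible.extend {G : Term K → Term K → Prop} (hG : Admissible G) (k : ℕ)
    (a b : Term K) : Admissible (Extend G k a b) where
  same s t h := ⟨fun _ _ => hG.same s t h, fun h1 h2 => absurd (h ▸ h1) h2,
    fun h1 h2 => absurd (h ▸ h1) h2⟩
  shift s t d h := by
    refine ⟨fun h1 h2 => hG.shift s t d (h.1 h1 h2), fun h1 h2 => ?_, fun h1 h2 => ?_⟩
    · obtain ⟨c, rfl, rfl⟩ := h.2.1 h1 h2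
      exact ⟨c + d, rfl, by simp [Term.shift, add_assoc]⟩
    · obtain ⟨c, rfl, rfl⟩ := h.2.2 h1 h2
      exact ⟨c + d, rfl, by simp [Term.shift, add_assoc]⟩

theorem Extend.left_mk {G : Term K → Term K → Prop} {k : ℕ} {a b : Term K} (hb : b.1 ≠ k) (d : K) :
    Extend G k a b (k, d) (b.shift d) :=
  ⟨fun h => absurd rfl h, fun _ _ => ⟨d, rfl, rfl⟩, fun h => absurd h hb⟩

theorem Extend.right_mk {G : Term K → Term K → Prop} {k : ℕ} {a b : Term K} (ha : a.1 ≠ k) (d : K) :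
    Extend G k a b (a.shift d) (k, d) :=
  ⟨fun _ h => absurd rfl h, fun h => absurd h ha, fun _ _ => ⟨d, rfl, rfl⟩⟩

theorem Extend.of_ne {G : Term K → Term K → Prop} {k : ℕ} {a b s t : Term K} (hs : s.1 ≠ k)
    (ht : t.1 ≠ k) (h : G s t) : Extend G k a b s t :=
  ⟨fun _ _ => h, fun h => absurd h hs, fun h => absurd h ht⟩

theorem Splits.extend {w : ℕ} {lo hi : ℕ → Option K} {G : Term K → Term K → Prop} {k : ℕ}
    {a b s t : Term K} {l h : Option K} (hw : w ≠ k) (hs : s.1 ≠ k) (ht : t.1 ≠ k)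
    (H : Splits w lo hi G s t) :
    Splits w (Function.update lo k l) (Function.update hi k h) (Extend G k a b) s t := by
  have key (m : Term K) :
      Cross w (Function.update lo k l) (Function.update hi k h) s t m ↔ Cross w lo hi s t m := by
    constructor
    · rintro ⟨h1, h2, h3, h4, h5⟩
      exact ⟨h1, by simpa [hs] using h2, by simpa [ht] using h3, h4, h5⟩
    · rintro ⟨h1, h2, h3, h4, h5⟩
      exact ⟨h1, by simpa [hs] using h2, by simpa [ht] using h3, h4, h5⟩
  refine ⟨fun m hm => ?_, fun hm => ?_⟩
  · have hm := (key m).1 hm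
    have hmk : m.1 ≠ k := hm.base.trans_ne hw
    exact ⟨.of_ne hs hmk (H.1 m hm).1, .of_ne hmk ht (H.1 m hm).2⟩
  · exact .of_ne hs ht (H.2 fun m hc => hm m ((key m).2 hc))

theorem Splits.of_not_cross {w : ℕ} {lo hi : ℕ → Option K} {G : Term K → Term K → Prop}
    {a b : Term K} (h : ∀ m, ¬ Cross w lo hi a b m) (hG : G a b) : Splits w lo hi G a b :=
  ⟨fun m hm => absurd hm (h m), fun _ => hG⟩

theorem Cross.unique {w : ℕ} {lo hi : ℕ → Option K} {a b c m m' : Term K} {d : K}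
    (h : Cross w lo hi a b m) (h' : Cross w lo hi c (b.shift d) m') : m' = m.shift d := by
  have h1 := Option.some.inj (h.right.symm.trans h'.right)
  refine Prod.ext (h'.base.trans h.base.symm) ?_
  simp only [Term.shift] at h1 ⊢
  rw [← sub_add_cancel m'.2 (b.2 + d), ← h1]
  abel

theorem Cross.unique_left {w : ℕ} {lo hi : ℕ → Option K} {a b c m m' : Term K} {d : K}
    (h : Cross w lo hi a b m) (h' : Cross w lo hi (a.shift d) c m') : m' = m.shift d := by
  have h1 := Option.some.inj (h.left.symm.trans h'.left)
  refine Prod.ext (h'.base.trans h.base.symm) ?_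
  simp only [Term.shift] at h1 ⊢
  rw [← sub_add_cancel m'.2 (a.2 + d), ← h1]
  abel

theorem IntervalsIn.body {σ : ℕ → Term K} {R R' : Term K → Term K → Prop} {z : ℕ} {p q τ : Term K}
    {φ : FO K P} (hp : p.1 ≠ z) (hq : q.1 ≠ z) (hφ : BodyCond z p q φ)
    (hR : IntervalsIn σ R (guard p q z φ))
    (hne : ∀ s t : Term K, s.1 ∈ φ.free → s.1 ≠ z → t.1 ∈ φ.free → t.1 ≠ z →
      R (Term.subst σ s) (Term.subst σ t) → R' (Term.subst σ s) (Term.subst σ t))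
    (hl : ∀ d, R' (τ.shift d) ((Term.subst σ q).shift d))
    (hr : ∀ d, R' ((Term.subst σ p).shift d) (τ.shift d))
    (hlr : ∀ d d', R' (τ.shift d) (τ.shift d')) :
    IntervalsIn (Function.update σ z τ) R' φ := by
  have hu (t : Term K) (ht : t.1 ≠ z) :
      Term.subst (Function.update σ z τ) t = Term.subst σ t := by simp [Term.subst, ht]
  have hz (t : Term K) (ht : t.1 = z) :
      Term.subst (Function.update σ z τ) t = τ.shift t.2 := by simp [Term.subst, ht]
  intro s t hst hs ht
  by_cases hsz : s.1 = z <;> by_cases htz : t.1 = z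
  · rw [hz s hsz, hz t htz]
    exact hlr _ _
  · obtain ⟨c, rfl, rfl⟩ := (hφ s t hst).1 hsz htz ht
    rw [hz (z, c) rfl, hu (q.1, q.2 + c) hq, Term.subst_mk_add]
    exact hl c
  · obtain ⟨c, rfl, rfl⟩ := (hφ s t hst).2 htz hsz hs
    rw [hz (z, c) rfl, hu (p.1, p.2 + c) hp, Term.subst_mk_add]
    exact hr c
  · rw [hu s hsz, hu t htz]
    exact hne s t hs hsz ht htz (hR s t (mem_intervals_guard.2 (Or.inr hst))
      ((mem_free_guard hp hq).2 (by tauto)) ((mem_free_guard hp hq).2 (by tauto)))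

theorem IsTranslation.guard_isHIF {w : ℕ} {σ : ℕ → Term K} {lo hi : ℕ → Option K}
    {G : Term K → Term K → Prop} {n k : ℕ} {a b : Term K} {φ T : FO K P}
    (hT : IsTranslation w σ lo hi (Extend G k a b) n φ T) (hk : k < n) (ha : a.1 ≠ k)
    (hb : b.1 ≠ k) : (guard a b k T).IsHIF := by
  refine IsHIF.exI hT.isHIF ha hb fun s t hst => ⟨fun h1 h2 h3 => ?_, fun h1 h2 h3 => ?_⟩
  · exact (hT.mem_intervals s t hst (h1 ▸ hk) (hT.free_lt _ h3)).2.1 h1 h2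
  · exact (hT.mem_intervals s t hst (hT.free_lt _ h3) (h1 ▸ hk)).2.2 h1 h2

theorem Sound.update {w : ℕ} {lo hi : ℕ → Option K} {v : ℕ → ℝ} (hv : Sound w lo hi v) {k : ℕ}
    (hk : w ≠ k) {l h : Option K} {r : ℝ} (hl : ∀ e, l = some e → r < v w + e)
    (hh : ∀ e, h = some e → v w + e < r) :
    Sound w (Function.update lo k l) (Function.update hi k h) (Function.update v k r) := by
  refine ⟨fun x e hx => ?_, fun x e hx => ?_⟩
  · rw [Function.update_of_ne hk]
    by_cases hxk : x = k
    · subst hxk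
      simpa using hl e (by simpa using hx)
    · rw [Function.update_of_ne hxk] at hx ⊢
      exact hv.1 x e hx
  · rw [Function.update_of_ne hk]
    by_cases hxk : x = k
    · subst hxk
      simpa using hh e (by simpa using hx)
    · rw [Function.update_of_ne hxk] at hx ⊢
      exact hv.2 x e hx

section Body

variable {w : ℕ} {σ : ℕ → Term K} {lo hi : ℕ → Option K} {G : Term K → Term K → Prop}
  {n k z : ℕ} {p q m : Term K} {φ : FO K P}

/-- The body of a guarded quantifier on `z` has a translation in which `z` becomes `k`. -/
theorem Translatable.exists_body (hφ : Translatable w φ) (hp : p.1 ≠ z) (hq : q.1 ≠ z)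
    (hb : BodyCond z p q φ) (hG : Admissible G)
    (hI : IntervalsIn σ (Splits w lo hi G) (guard p q z φ)) (hw : w < n) (hwk : w ≠ k) (hk : k < n)
    (hσ : ∀ x ∈ φ.free, x ≠ z → (σ x).1 < n ∧ (σ x).1 ≠ k) {a b : Term K} {l h : Option K}
    (hlh : l = none ∨ h = none)
    (hl : ∀ d, Splits w (Function.update lo k l) (Function.update hi k h) (Extend G k a b)
      (k, d) ((Term.subst σ q).shift d))
    (hr : ∀ d, Splits w (Function.update lo k l) (Function.update hi k h) (Extend G k a b)
      ((Term.subst σ p).shift d) (k, d)) :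
    ∃ T, IsTranslation w (Function.update σ z (k, 0)) (Function.update lo k l)
      (Function.update hi k h) (Extend G k a b) n φ T := by
  have e (d : K) : Term.shift ((k, 0) : Term K) d = (k, d) := by simp [Term.shift]
  refine hφ _ _ _ _ n hw ?_ (hG.extend k a b) (hI.body hp hq hb ?_ ?_ ?_ ?_)
  · intro x hx
    by_cases hxz : x = z
    · subst hxz
      simpa using hk
    · simpa [hxz] using (hσ x hx hxz).1
  · intro s t hs hsz ht htz hst
    exact hst.extend hwk (hσ _ hs hsz).2 (hσ _ ht htz).2
  · intro d
    rw [e]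
    exact hl d
  · intro d
    rw [e]
    exact hr d
  · intro d d'
    rw [e, e]
    refine .of_not_cross (fun m hm => ?_) ((hG.extend k a b).same _ _ rfl)
    have h1 := hm.left
    have h2 := hm.right
    rcases hlh with rfl | rfl
    · simp at h1
    · simp at h2

theorem update_agree (hσ : ∀ x ∈ φ.free, x ≠ z → (σ x).1 ≠ k) {v v' : ℕ → ℝ}
    (hv : ∀ x ∈ φ.free, x ≠ z → v' x = (σ x).val v) (r : ℝ) :
    ∀ x ∈ φ.free, Function.update v' z r x =
      (Function.update σ z ((k, 0) : Term K) x).val (Function.update v k r) := by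
  intro x hx
  by_cases hxz : x = z
  · subst hxz
    simp [Term.val]
  · simp only [Function.update_of_ne hxz]
    rw [Term.val_update (hσ x hx hxz), hv x hx hxz]

/-- A guarded quantifier whose interval has a splitting point is split there. -/
theorem Translatable.exists_split (hφ : Translatable w φ) (hp : p.1 ≠ z) (hq : q.1 ≠ z)
    (hb : BodyCond z p q φ) (hG : Admissible G)
    (hI : IntervalsIn σ (Splits w lo hi G) (guard p q z φ)) {n' : ℕ} (hw : w < n) (hwk : w ≠ k)
    (hn : n ≤ n') (hk : k < n') (hσ : ∀ x ∈ (guard p q z φ).free, (σ x).1 < n ∧ (σ x).1 ≠ k)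
    (hm : Cross w lo hi (Term.subst σ p) (Term.subst σ q) m) :
    ∃ Tl Tm Tr : FO K P,
      IsTranslation w (Function.update σ z (k, 0)) (Function.update lo k (some m.2))
        (Function.update hi k none) (Extend G k (Term.subst σ p) m) n' φ Tl ∧
      IsTranslation w (Function.update σ z m) lo hi G n φ Tm ∧
      IsTranslation w (Function.update σ z (k, 0)) (Function.update lo k none)
        (Function.update hi k (some m.2)) (Extend G k m (Term.subst σ q)) n' φ Tr ∧
      ∀ (f : ℝ → Set P) (v v' : ℕ → ℝ), Sound w lo hi v →
        (∀ x ∈ (guard p q z φ).free, v' x = (σ x).val v) →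
        ((guard p q z φ).sat f v' ↔ (guard (Term.subst σ p) m k Tl).sat f v ∨ Tm.sat f v ∨
          (guard m (Term.subst σ q) k Tr).sat f v) := by
  have hfree {x : ℕ} (hx : x ∈ φ.free) (hxz : x ≠ z) : x ∈ (guard p q z φ).free :=
    (mem_free_guard hp hq).2 (Or.inr (Or.inr ⟨hx, hxz⟩))
  have hpf : p.1 ∈ (guard p q z φ).free := (mem_free_guard hp hq).2 (Or.inl rfl)
  have hqf : q.1 ∈ (guard p q z φ).free := (mem_free_guard hp hq).2 (Or.inr (Or.inl rfl))
  have hpk : (Term.subst σ p).1 ≠ k := (hσ _ hpf).2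
  have hqk : (Term.subst σ q).1 ≠ k := (hσ _ hqf).2
  have hmk : m.1 ≠ k := hm.base.trans_ne hwk
  obtain ⟨hGl, hGr⟩ := (hI p q (mem_intervals_guard.2 (Or.inl rfl)) hpf hqf).1 m hm
  have hσ' : ∀ x ∈ φ.free, x ≠ z → (σ x).1 < n' ∧ (σ x).1 ≠ k := fun x hx hxz =>
    ⟨(hσ x (hfree hx hxz)).1.trans_le hn, (hσ x (hfree hx hxz)).2⟩
  obtain ⟨Tl, hTl⟩ := hφ.exists_body (a := Term.subst σ p) (b := m) (l := some m.2) (h := none)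
    hp hq hb hG hI (hw.trans_le hn) hwk hk hσ' (Or.inr rfl)
    (by
      intro d
      refine ⟨fun m' hm' => ?_, fun hm' => ?_⟩
      · obtain rfl : m' = m.shift d := by
          refine Prod.ext (hm'.base.trans hm.base.symm) ?_
          have h1 := hm'.left
          simp only [Function.update_self, Option.some.injEq] at h1
          simp [Term.shift, h1]
        exact ⟨.left_mk hmk d, .of_ne hmk hqk (hG.shift _ _ d hGr)⟩
      · refine absurd ⟨hm.base, ?_, ?_, ?_, ?_⟩ (hm' (m.shift d))
        · simp [Term.shift]
        · have := hm.right
          simpa [Term.shift, hqk] using this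
        · exact fun h => hmk (congrArg Prod.fst h).symm
        · exact fun h => hm.ne_right (Term.shift_injective d h))
    (by
      intro d
      refine .of_not_cross (fun m' hm' => ?_) (.right_mk hpk d)
      simpa using hm'.right)
  obtain ⟨Tr, hTr⟩ := hφ.exists_body (a := m) (b := Term.subst σ q) (l := none) (h := some m.2)
    hp hq hb hG hI (hw.trans_le hn) hwk hk hσ' (Or.inl rfl)
    (by
      intro d
      refine .of_not_cross (fun m' hm' => ?_) (.left_mk hqk d)
      simpa using hm'.left)
    (by
      intro d
      refine ⟨fun m' hm' => ?_, fun hm' => ?_⟩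
      · obtain rfl : m' = m.shift d := by
          refine Prod.ext (hm'.base.trans hm.base.symm) ?_
          have h1 := hm'.right
          simp only [Function.update_self, Option.some.injEq] at h1
          simp [Term.shift, h1]
        exact ⟨.of_ne hpk hmk (hG.shift _ _ d hGl), .right_mk hmk d⟩
      · refine absurd ⟨hm.base, ?_, ?_, ?_, ?_⟩ (hm' (m.shift d))
        · have := hm.left
          simpa [Term.shift, hpk] using this
        · simp [Term.shift]
        · exact fun h => hm.ne_left (Term.shift_injective d h)
        · exact fun h => hmk (congrArg Prod.fst h).symm)
  obtain ⟨Tm, hTm⟩ : ∃ T, IsTranslation w (Function.update σ z m) lo hi G n φ T := by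
    refine hφ _ _ _ _ n hw ?_ hG (hI.body hp hq hb ?_ ?_ ?_ ?_)
    · intro x hx
      by_cases hxz : x = z
      · subst hxz
        simpa [hm.base] using hw
      · simpa [hxz] using (hσ x (hfree hx hxz)).1
    · exact fun _ _ _ _ _ _ h => h
    · exact fun d => .of_not_cross (fun m' hm' => hm'.ne_left (hm.unique hm').symm)
        (hG.shift _ _ d hGr)
    · exact fun d => .of_not_cross (fun m' hm' => hm'.ne_right (hm.unique_left hm').symm)
        (hG.shift _ _ d hGl)
    · exact fun d d' => ⟨fun m' hm' => ⟨hG.same _ _ (hm.base.trans hm'.base.symm),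
        hG.same _ _ (hm'.base.trans hm.base.symm)⟩, fun _ => hG.same _ _ rfl⟩
  refine ⟨Tl, Tm, Tr, hTl, hTm, hTr, fun f v v' hv hvv => ?_⟩
  have hvφ : ∀ x ∈ φ.free, x ≠ z → v' x = (σ x).val v := fun x hx hxz => hvv x (hfree hx hxz)
  have hag (r : ℝ) := update_agree (k := k) (fun x hx hxz => (hσ' x hx hxz).2) hvφ r
  have hml : m.val v = v w + m.2 := by rw [← hm.base]; rfl
  have hl (r : ℝ) (hr : r < m.val v) := hTl.sat_iff f _ _ (hv.update (h := none) hwk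
    (fun e he => by obtain rfl := Option.some.inj he; rwa [← hml]) (fun e he => by simp at he))
    (hag r)
  have hr (r : ℝ) (hr : m.val v < r) := hTr.sat_iff f _ _ (hv.update (l := none) hwk
    (fun e he => by simp at he) (fun e he => by obtain rfl := Option.some.inj he; rwa [← hml]))
    (hag r)
  have hc : Tm.sat f v ↔ φ.sat f (Function.update v' z (m.val v)) := by
    refine hTm.sat_iff f _ _ hv fun x hx => ?_
    by_cases hxz : x = z
    · subst hxz
      simp
    · simpa [hxz] using hvφ x hx hxz
  obtain ⟨hpm, hmq⟩ := hm.lt hv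
  rw [sat_guard hp hq, sat_guard hpk hmk, sat_guard hmk hqk, hc]
  rw [Term.val_subst (hvv _ hpf)] at hpm ⊢
  rw [Term.val_subst (hvv _ hqf)] at hmq ⊢
  constructor
  · rintro ⟨r, h1, h2, h3⟩
    rcases lt_trichotomy r (m.val v) with h | rfl | h
    · exact Or.inl ⟨r, h1, h, (hl r h).2 h3⟩
    · exact Or.inr (Or.inl h3)
    · exact Or.inr (Or.inr ⟨r, h, h2, (hr r h).2 h3⟩)
  · rintro (⟨r, h1, h2, h3⟩ | h | ⟨r, h1, h2, h3⟩)
    · exact ⟨r, h1, h2.trans hmq, (hl r h2).1 h3⟩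
    · exact ⟨_, hpm, hmq, h⟩
    · exact ⟨r, hpm.trans h1, h2, (hr r h1).1 h3⟩

end Body

theorem IsTranslation.mem_free_guard_lt {w : ℕ} {σ : ℕ → Term K} {lo hi : ℕ → Option K}
    {G : Term K → Term K → Prop} {n : ℕ} {a b : Term K} {φ T : FO K P}
    (hT : IsTranslation w σ lo hi (Extend G n a b) (n + 1) φ T) (ha : a.1 < n)
    (hb : b.1 < n) {x : ℕ} (hx : x ∈ (guard a b n T).free) : x < n := by
  rcases (mem_free_guard ha.ne hb.ne).1 hx with rfl | rfl | ⟨hx, hxn⟩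
  · exact ha
  · exact hb
  · have := hT.free_lt x hx
    omega

theorem IsTranslation.mem_intervals_guard_imp {w : ℕ} {σ : ℕ → Term K} {lo hi : ℕ → Option K}
    {G : Term K → Term K → Prop} {n : ℕ} {a b : Term K} {φ T : FO K P}
    (hT : IsTranslation w σ lo hi (Extend G n a b) (n + 1) φ T) (hab : G a b) {s t : Term K}
    (hst : (s, t) ∈ (guard a b n T).intervals) (hs : s.1 < n) (ht : t.1 < n) : G s t := by
  rcases mem_intervals_guard.1 hst with h | h
  · obtain ⟨rfl, rfl⟩ := Prod.ext_iff.1 h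
    exact hab
  · exact (hT.mem_intervals s t h (hs.trans n.lt_succ_self) (ht.trans n.lt_succ_self)).1 hs.ne ht.ne

theorem Translatable.guard {w z : ℕ} {p q : Term K} {φ : FO K P} (hφ : Translatable w φ)
    (hp : p.1 ≠ z) (hq : q.1 ≠ z) (hb : BodyCond z p q φ) : Translatable w (guard p q z φ) := by
  intro σ lo hi G n hw hσ hG hI
  have hpf : p.1 ∈ (FO.guard p q z φ).free := (mem_free_guard hp hq).2 (Or.inl rfl)
  have hqf : q.1 ∈ (FO.guard p q z φ).free := (mem_free_guard hp hq).2 (Or.inr (Or.inl rfl))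
  have hpn : (Term.subst σ p).1 < n := hσ _ hpf
  have hqn : (Term.subst σ q).1 < n := hσ _ hqf
  have hpq := hI p q (mem_intervals_guard.2 (Or.inl rfl)) hpf hqf
  by_cases hm : ∃ m, Cross w lo hi (Term.subst σ p) (Term.subst σ q) m
  · obtain ⟨m, hm⟩ := hm
    obtain ⟨Tl, Tm, Tr, hl, hc, hr, hsat⟩ := hφ.exists_split hp hq hb hG hI hw hw.ne n.le_succ
      n.lt_succ_self (fun x hx => ⟨hσ x hx, (hσ x hx).ne⟩) hm
    obtain ⟨hGl, hGr⟩ := hpq.1 m hm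
    have hmn : m.1 < n := hm.base.trans_lt hw
    refine ⟨disj (FO.guard (Term.subst σ p) m n Tl)
      (disj Tm (FO.guard m (Term.subst σ q) n Tr)), ?_, ?_, ?_, ?_, ?_⟩
    · exact .disjI (hl.guard_isHIF n.lt_succ_self hpn.ne hmn.ne)
        (.disjI hc.isHIF (hr.guard_isHIF n.lt_succ_self hmn.ne hqn.ne))
    · have := hl.qdepth_le
      have := hc.qdepth_le
      have := hr.qdepth_le
      simp only [disj, qdepth, qdepth_guard]
      omega
    · rintro x (hx | hx | hx)
      · exact hl.mem_free_guard_lt hpn hmn hx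
      · exact hc.free_lt x hx
      · exact hr.mem_free_guard_lt hmn hqn hx
    · rintro a b (h | h | h) ha hb
      · exact hl.mem_intervals_guard_imp hGl h ha hb
      · exact hc.mem_intervals a b h ha hb
      · exact hr.mem_intervals_guard_imp hGr h ha hb
    · intro f v v' hv hvv
      rw [sat_disj, sat_disj]
      exact (hsat f v v' hv hvv).symm
  · have hfree {x : ℕ} (hx : x ∈ φ.free) (hxz : x ≠ z) : x ∈ (FO.guard p q z φ).free :=
      (mem_free_guard hp hq).2 (Or.inr (Or.inr ⟨hx, hxz⟩))
    have hσ' : ∀ x ∈ φ.free, x ≠ z → (σ x).1 < n + 1 ∧ (σ x).1 ≠ n := fun x hx hxz =>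
      ⟨(hσ x (hfree hx hxz)).trans n.lt_succ_self, (hσ x (hfree hx hxz)).ne⟩
    obtain ⟨T, hT⟩ := hφ.exists_body (a := Term.subst σ p) (b := Term.subst σ q) (l := none)
      (h := none) hp hq hb hG hI (hw.trans n.lt_succ_self) hw.ne n.lt_succ_self hσ' (Or.inl rfl)
      (fun d => .of_not_cross (fun m' hm' => by simpa using hm'.left) (.left_mk hqn.ne d))
      (fun d => .of_not_cross (fun m' hm' => by simpa using hm'.right) (.right_mk hpn.ne d))
    refine ⟨FO.guard _ _ n T, hT.guard_isHIF n.lt_succ_self hpn.ne hqn.ne, ?_,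
      fun x hx => hT.mem_free_guard_lt hpn hqn hx,
      fun a b h ha hb => hT.mem_intervals_guard_imp (hpq.2 (not_exists.1 hm)) h ha hb, ?_⟩
    · have := hT.qdepth_le
      simp only [qdepth_guard]
      omega
    · intro f v v' hv hvv
      rw [sat_guard hp hq, sat_guard hpn.ne hqn.ne, Term.val_subst (hvv _ hpf),
        Term.val_subst (hvv _ hqf)]
      refine exists_congr fun r => and_congr_right fun _ => and_congr_right fun _ => ?_
      exact hT.sat_iff f _ _ (hv.update hw.ne (by simp) (by simp))
        (update_agree (fun x hx hxz => (hσ' x hx hxz).2) (fun x hx hxz => hvv x (hfree hx hxz)) r)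

theorem IsHIF.translatable {φ : FO K P} (h : φ.IsHIF) (w : ℕ) : Translatable w φ := by
  induction h with
  | base hq hlt =>
    intro σ lo hi G n _ hσ _ _
    obtain ⟨T, T1, T2, T3, T4⟩ := hq.exists_subst hlt σ n hσ
    exact ⟨T, .base T1 T2, by simp [T1.qdepth_eq], T3, by simp [T1.intervals_eq],
      fun f v v' _ hv => T4 f v v' hv⟩
  | negI _ ih =>
    intro σ lo hi G n hw hσ hG hI
    obtain ⟨T, hT⟩ := ih σ lo hi G n hw hσ hG hI
    exact ⟨neg T, .negI hT.isHIF, hT.qdepth_le, hT.free_lt, hT.mem_intervals,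
      fun f v v' hv hvv => not_congr (hT.sat_iff f v v' hv hvv)⟩
  | disjI _ _ ih1 ih2 =>
    intro σ lo hi G n hw hσ hG hI
    obtain ⟨S, hS⟩ := ih1 σ lo hi G n hw (fun x hx => hσ x (Or.inl hx)) hG
      fun p q h hp hq => hI p q (Or.inl h) (Or.inl hp) (Or.inl hq)
    obtain ⟨T, hT⟩ := ih2 σ lo hi G n hw (fun x hx => hσ x (Or.inr hx)) hG
      fun p q h hp hq => hI p q (Or.inr h) (Or.inr hp) (Or.inr hq)
    refine ⟨disj S T, .disjI hS.isHIF hT.isHIF, max_le_max hS.qdepth_le hT.qdepth_le, ?_, ?_, ?_⟩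
    · rintro x (hx | hx)
      exacts [hS.free_lt x hx, hT.free_lt x hx]
    · rintro a b (h | h)
      exacts [hS.mem_intervals a b h, hT.mem_intervals a b h]
    · intro f v v' hv hvv
      exact not_congr (and_congr
        (not_congr (hS.sat_iff f v v' hv fun x hx => hvv x (Or.inl hx)))
        (not_congr (hT.sat_iff f v v' hv fun x hx => hvv x (Or.inr hx))))
  | exI _ hxl hxr hb ih => exact ih.guard hxl hxr hb

theorem IsHIF.of_guard {s t : Term K} {y : ℕ} {φ : FO K P} (h : (guard s t y φ).IsHIF) :
    φ.IsHIF ∧ s.1 ≠ y ∧ t.1 ≠ y ∧ BodyCond y s t φ := by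
  generalize hg : guard s t y φ = χ at h
  cases h with
  | base hq => subst hg; exact hq.elim
  | negI => cases hg
  | disjI => cases hg
  | exI hφ hxl hxr hb =>
    cases hg
    exact ⟨hφ, hxl, hxr, hb⟩

end FO


/-- **Lemma 9.** Let `φ(x̄) = ∃ y ∈ (s,t). ψ(x̄,y)` be a HIF and `u` a term over the
variables `x̄`.  Then there are HIFs `θ^< = ∃ y ∈ (s,u). ψ^<`, `θ^> = ∃ y ∈ (u,t). ψ^>` and a
HIF `θ^=` of strictly smaller quantifier depth than `φ`, such that whenever `s < u < t`,
`φ` holds iff `θ^< ∨ θ^= ∨ θ^>` holds. -/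
theorem hif_split (K : AddSubgroup ℝ) (s t : Term K) (y : ℕ) (ψ : FO K ℕ)
    (hH : (FO.guard s t y ψ).IsHIF) (u : Term K) (hu : u.1 ≠ y) :
    ∃ ψl ψr θeq : FO K ℕ,
      (FO.guard s u y ψl).IsHIF ∧ (FO.guard u t y ψr).IsHIF ∧ θeq.IsHIF ∧
      θeq.qdepth < (FO.guard s t y ψ).qdepth ∧
      ∀ (f : ℝ → Set ℕ) (v : ℕ → ℝ),
        Term.val v s < Term.val v u → Term.val v u < Term.val v t →
        ((FO.guard s t y ψ).sat f v ↔
          (FO.guard s u y ψl).sat f v ∨ θeq.sat f v ∨ (FO.guard u t y ψr).sat f v) := by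
  obtain ⟨hψ, hs, ht, hb⟩ := hH.of_guard
  by_cases hsu : s = u
  · refine ⟨.tt, .tt, .tt, .exI (.base trivial trivial) hs hu (by simp [FO.intervals]),
      .exI (.base trivial trivial) hu ht (by simp [FO.intervals]), .base trivial trivial,
      by simp [FO.qdepth, FO.qdepth_guard], fun f v h => absurd h (by simp [hsu])⟩
  by_cases htu : t = u
  · refine ⟨.tt, .tt, .tt, .exI (.base trivial trivial) hs hu (by simp [FO.intervals]),
      .exI (.base trivial trivial) hu ht (by simp [FO.intervals]), .base trivial trivial,
      by simp [FO.qdepth, FO.qdepth_guard], fun f v _ h => absurd h (by simp [htu])⟩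
  obtain ⟨N, hN⟩ := (FO.guard s t y ψ).exists_free_lt
  let σ : ℕ → Term K := fun x => (x, 0)
  let lo : ℕ → Option K := Function.update (fun _ => none) s.1 (some (u.2 - s.2))
  let hi : ℕ → Option K := Function.update (fun _ => none) t.1 (some (u.2 - t.2))
  have hσ (a : Term K) : Term.subst σ a = a := by simp [σ, Term.subst, Term.shift]
  have hcross : FO.Cross u.1 lo hi (Term.subst σ s) (Term.subst σ t) u := by
    rw [hσ, hσ]
    exact ⟨rfl, by simp [lo], by simp [hi], hsu, htu⟩
  obtain ⟨Tl, Tm, Tr, hl, hm, hr, hsat⟩ :=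
    (hψ.translatable u.1).exists_split (G := fun _ _ => True) (n := N + u.1 + y + 1) (k := y)
      hs ht hb ⟨fun _ _ _ => trivial, fun _ _ _ _ => trivial⟩
      (fun _ _ _ _ _ => ⟨fun _ _ => ⟨trivial, trivial⟩, fun _ => trivial⟩)
      (by omega) hu le_rfl (by omega)
      (fun x hx => ⟨by have := hN x hx; simp only [σ]; omega, by
        rcases (FO.mem_free_guard hs ht).1 hx with rfl | rfl | h
        exacts [hs, ht, h.2]⟩) hcross
  rw [hσ] at hl
  rw [hσ] at hr
  simp only [hσ] at hsat
  refine ⟨Tl, Tr, Tm, hl.guard_isHIF (by omega) hs hu, hr.guard_isHIF (by omega) hu ht, hm.isHIF,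
    ?_, fun f v h1 h2 => hsat f v v ⟨fun x e hx => ?_, fun x e hx => ?_⟩ ?_⟩
  · rw [FO.qdepth_guard]
    exact Nat.lt_succ_of_le hm.qdepth_le
  · by_cases hxs : x = s.1
    · subst hxs
      obtain rfl : u.2 - s.2 = e := by simpa [lo] using hx
      simp only [Term.val] at h1
      push_cast
      linarith
    · simp [lo, hxs] at hx
  · by_cases hxt : x = t.1
    · subst hxt
      obtain rfl : u.2 - t.2 = e := by simpa [hi] using hx
      simp only [Term.val] at h2
      push_cast
      linarith
    · simp [hi, hxt] at hx
  · intro x _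
    simp [σ, Term.val]

end MTLPaper
end
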